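/- Let n ≥ 3 and let Δ be a finite-index subgroup of SL_n(ℤ). Then Δ is finitely generated and residually finite, and for every finite generating set Y of Δ one has F_{Δ,Y}(N) ≽ N^{n²−1}. (Theorem 1.1 / Theorem 3.12 instantiated at G = SL_n, K = ℚ, f = 1.) -/

import Mathlib

open scoped Pointwise

section FarbDefs

variable {G : Type*} [Group G]

/-- Word length of `g` with respect to a generating set `X` (symmetrized). -/
noncomputable def wordLength (X : Set G) (g : G) : ℕ :=
  sInf {n | ∃ l : List G, l.length = n ∧ (∀ x ∈ l, x ∈ X ∨ x⁻¹ ∈ X) ∧ l.prod = g}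

/-- `farbD g` is the minimal cardinality of a finite quotient of `G` detecting `g`. -/
noncomputable def farbD (g : G) : ℕ :=
  sInf {k | ∃ N : Subgroup G, N.Normal ∧ N.FiniteIndex ∧ g ∉ N ∧ N.index = k}

/-- The normal Farb growth function of `G` with respect to `X`. -/
noncomputable def farbF (X : Set G) (n : ℕ) : ℕ :=
  sSup {d | ∃ g : G, g ≠ 1 ∧ wordLength X g ≤ n ∧ farbD g = d}

/-- The auxiliary function `F^k`. -/
noncomputable def farbFk (k : ℕ) (X : Set G) (n : ℕ) : ℕ :=
  sSup {d | ∃ g : G, g ^ k ≠ 1 ∧ wordLength X g ≤ n ∧ farbD (g ^ k) = d}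

/-- `f ≼ g` : there is `M` with `f n ≤ M * g (M * n)` for all `n`. -/
def FarbPreceq (f g : ℕ → ℕ) : Prop := ∃ M : ℕ, 0 < M ∧ ∀ n, f n ≤ M * g (M * n)

/-- `f ≈ g`. -/
def FarbEquiv (f g : ℕ → ℕ) : Prop := FarbPreceq f g ∧ FarbPreceq g f

/-- A group is residually finite if every nontrivial element is detected by a
finite quotient. -/
def ResiduallyFinite (G : Type*) [Group G] : Prop :=
  ∀ g : G, g ≠ 1 → ∃ N : Subgroup G, N.Normal ∧ N.FiniteIndex ∧ g ∉ N

end FarbDefs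

namespace Matrix.SpecialLinearGroup

section Elementary

variable {ι R : Type*} [Fintype ι] [DecidableEq ι] [CommRing R]

lemma transvection_mul_apply {i j : ι} (hij : i ≠ j) (b : R) (A : SpecialLinearGroup ι R)
    (l c : ι) :
    (transvection hij b * A) l c = A l c + if l = i then b * A j c else 0 := by
  split_ifs with h
  · subst h
    exact Matrix.transvection_mul_apply_same l j c b (A : Matrix ι ι R)
  · rw [add_zero]
    exact Matrix.transvection_mul_apply_of_ne i j l c h b (A : Matrix ι ι R)

variable (ι R) in
/-- The subgroup generated by all transvections. -/
def elementary : Subgroup (SpecialLinearGroup ι R) :=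
  Subgroup.closure {g | ∃ (i j : ι) (hij : i ≠ j) (b : R), g = transvection hij b}

lemma transvection_mem_elementary {i j : ι} (hij : i ≠ j) (b : R) :
    transvection hij b ∈ elementary ι R :=
  Subgroup.subset_closure ⟨i, j, hij, b, rfl⟩

/-- The Euclidean algorithm on two rows: an elementary matrix supported on rows `i` and `j`
kills the entry in position `(j, k)`. -/
lemma exists_elementary_euclid (hR : Function.Surjective (Int.castRingHom R)) {i j : ι}
    (hij : i ≠ j) (k : ι) (A : SpecialLinearGroup ι R) :
    ∃ g ∈ elementary ι R, (g * A) j k = 0 ∧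
      (∀ l c, l ≠ i → l ≠ j → (g * A) l c = A l c) ∧
      (∀ c, A i c = 0 → A j c = 0 → (g * A) i c = 0 ∧ (g * A) j c = 0) := by
  obtain ⟨a, ha⟩ := hR (A i k)
  obtain ⟨b, hb⟩ := hR (A j k)
  induction hm : b.natAbs using Nat.strong_induction_on generalizing a b A with
  | _ m ih =>
    by_cases hb0 : b = 0
    · subst hb0
      exact ⟨1, one_mem _, by simpa using hb.symm, by simp, fun c h1 h2 => by simp [h1, h2]⟩
    set g₁ : SpecialLinearGroup ι R :=
      transvection hij.symm (-1) * transvection hij ((1 - a / b : ℤ) : R) with hg₁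
    have hi : ∀ c, (g₁ * A) i c = A i c + ((1 - a / b : ℤ) : R) * A j c := fun c => by
      rw [hg₁, mul_assoc, transvection_mul_apply, if_neg hij, add_zero, transvection_mul_apply,
        if_pos rfl]
    have hj : ∀ c, (g₁ * A) j c = A j c - (A i c + ((1 - a / b : ℤ) : R) * A j c) := fun c => by
      rw [hg₁, mul_assoc, transvection_mul_apply, if_pos rfl, transvection_mul_apply,
        if_neg hij.symm, transvection_mul_apply, if_pos rfl]
      ring
    have hl : ∀ l c, l ≠ i → l ≠ j → (g₁ * A) l c = A l c := fun l c h1 h2 => by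
      rw [hg₁, mul_assoc, transvection_mul_apply, if_neg h2, transvection_mul_apply, if_neg h1]
      ring
    have hlt : (-(a % b)).natAbs < m := by
      rw [Int.natAbs_neg, ← hm]
      have h1 := Int.emod_nonneg a hb0
      have h2 := Int.emod_lt_abs a hb0
      rw [← Int.natCast_natAbs] at h2
      omega
    simp only [eq_intCast] at ha hb
    have hab : (a : R) = b * ((a / b : ℤ) : R) + ((a % b : ℤ) : R) := by
      exact_mod_cast congrArg (Int.cast : ℤ → R) (Int.mul_ediv_add_emod a b).symm
    obtain ⟨g, hg, h1, h2, h3⟩ := ih _ hlt (g₁ * A) (a % b + b) (by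
        rw [hi, ← ha, ← hb, hab, eq_intCast]; push_cast; ring) (-(a % b)) (by
        rw [hj, ← ha, ← hb, hab, eq_intCast]; push_cast; ring) rfl
    refine ⟨g * g₁, mul_mem hg (mul_mem (transvection_mem_elementary _ _)
      (transvection_mem_elementary _ _)), by rwa [mul_assoc], fun l c hli hlj => ?_,
      fun c hic hjc => ?_⟩
    · rw [mul_assoc, h2 l c hli hlj, hl l c hli hlj]
    · rw [mul_assoc]
      exact h3 c (by rw [hi, hic, hjc]; ring) (by rw [hj, hic, hjc]; ring)

lemma exists_elementary_clear (hR : Function.Surjective (Int.castRingHom R)) {j : ι} (k : ι)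
    (A : SpecialLinearGroup ι R) (t : Finset ι) (hjt : j ∉ t) :
    ∃ g ∈ elementary ι R, (∀ l ∈ t, (g * A) l k = 0) ∧
      (∀ l c, l ≠ j → l ∉ t → (g * A) l c = A l c) ∧
      (∀ c, A j c = 0 → (∀ l ∈ t, A l c = 0) → (g * A) j c = 0 ∧ ∀ l ∈ t, (g * A) l c = 0) := by
  induction t using Finset.induction_on with
  | empty => exact ⟨1, one_mem _, by simp, by simp, fun c h _ => by simp [h]⟩
  | insert x t hx ih =>
    simp only [Finset.mem_insert, not_or] at hjt
    obtain ⟨g, hg, h1, h2, h3⟩ := ih hjt.2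
    obtain ⟨g', hg', h1', h2', h3'⟩ := exists_elementary_euclid hR hjt.1 k (g * A)
    have hne : ∀ l ∈ t, l ≠ j ∧ l ≠ x := fun l hl =>
      ⟨fun h => hjt.2 (h ▸ hl), fun h => hx (h ▸ hl)⟩
    refine ⟨g' * g, mul_mem hg' hg, ?_, ?_, ?_⟩
    · intro l hl
      rw [mul_assoc]
      rcases Finset.mem_insert.1 hl with rfl | hl
      · exact h1'
      · rw [h2' l k (hne l hl).1 (hne l hl).2, h1 l hl]
    · intro l c hlj hl
      simp only [Finset.mem_insert, not_or] at hl
      rw [mul_assoc, h2' l c hlj hl.1, h2 l c hlj hl.2]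
    · intro c hjc hc
      have hxc := hc x (Finset.mem_insert_self _ _)
      obtain ⟨h4, h5⟩ := h3 c hjc fun l hl => hc l (Finset.mem_insert_of_mem hl)
      obtain ⟨h6, h7⟩ := h3' c h4 (by rw [h2 x c (Ne.symm hjt.1) hx, hxc])
      rw [mul_assoc]
      refine ⟨h6, fun l hl => ?_⟩
      rcases Finset.mem_insert.1 hl with rfl | hl
      · exact h7
      · rw [h2' l c (hne l hl).1 (hne l hl).2, h5 l hl]

/-- Clearing a column which has a pivot equal to `1`. -/
lemma exists_elementary_clear_of_pivot {j : ι} (A : SpecialLinearGroup ι R) (hA : A j j = 1)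
    (t : Finset ι) (hjt : j ∉ t) :
    ∃ g ∈ elementary ι R, (∀ l ∈ t, (g * A) l j = 0) ∧ (∀ c, (g * A) j c = A j c) ∧
      (∀ l c, A j c = 0 → (g * A) l c = A l c) := by
  induction t using Finset.induction_on with
  | empty => exact ⟨1, one_mem _, by simp, by simp, fun l c h => by simp⟩
  | insert x t hx ih =>
    simp only [Finset.mem_insert, not_or] at hjt
    obtain ⟨g, hg, h1, h2, h3⟩ := ih hjt.2
    refine ⟨transvection (Ne.symm hjt.1) (-(g * A) x j) * g,
      mul_mem (transvection_mem_elementary _ _) hg, ?_, ?_, ?_⟩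
    · intro l hl
      rw [mul_assoc, transvection_mul_apply, h2, hA]
      rcases Finset.mem_insert.1 hl with rfl | hl
      · simp
      · rw [if_neg (ne_of_mem_of_not_mem hl hx), h1 l hl, add_zero]
    · intro c
      rw [mul_assoc, transvection_mul_apply, if_neg hjt.1, h2, add_zero]
    · intro l c hc
      rw [mul_assoc, transvection_mul_apply, h2, hc, h3 l c hc]
      simp

lemma mul_apply_eq_one_of_columns {A : SpecialLinearGroup ι R} {s : Finset ι} {j : ι}
    (hj : j ∉ s) (hs : ∀ c ∈ s, ∀ r, A r c = (1 : Matrix ι ι R) r c)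
    (hA : ∀ r ∉ s, r ≠ j → A r j = 0) : A⁻¹ j j * A j j = 1 := by
  have hB : ∀ c ∈ s, A⁻¹ j c = 0 := fun c hc => by
    have h : (A⁻¹ * A) j c = (1 : SpecialLinearGroup ι R) j c := by rw [inv_mul_cancel]
    rw [coe_mul, Matrix.mul_apply, coe_one, Finset.sum_eq_single c] at h
    · rw [hs c hc, one_apply_eq, mul_one, one_apply_ne (ne_of_mem_of_not_mem hc hj).symm] at h
      exact h
    · intro l _ hl
      rw [hs c hc, one_apply_ne hl, mul_zero]
    · simp
  have h : (A⁻¹ * A) j j = (1 : SpecialLinearGroup ι R) j j := by rw [inv_mul_cancel]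
  rw [coe_mul, Matrix.mul_apply, coe_one, Finset.sum_eq_single j] at h
  · rw [h, one_apply_eq]
  · intro l _ hl
    by_cases hls : l ∈ s
    · rw [hB l hls, zero_mul]
    · rw [hA l hls hl, mul_zero]
  · simp

lemma exists_elementary_columns (hR : Function.Surjective (Int.castRingHom R))
    (A : SpecialLinearGroup ι R) (s : Finset ι) :
    ∃ g ∈ elementary ι R, ∀ c ∈ s, ∀ r, (g * A) r c = (1 : Matrix ι ι R) r c := by
  induction s using Finset.induction_on with
  | empty => exact ⟨1, one_mem _, by simp⟩
  | insert j s hj ih =>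
    obtain ⟨g, hg, hs⟩ := ih
    suffices h : ∃ g' ∈ elementary ι R, (g' * (g * A)) j j = 1 ∧
        ∀ c ∈ s, ∀ r, (g' * (g * A)) r c = (1 : Matrix ι ι R) r c by
      obtain ⟨g', hg', h1, h2⟩ := h
      obtain ⟨g'', hg'', h3, h4, h5⟩ := exists_elementary_clear_of_pivot (g' * (g * A)) h1
        (Finset.univ.erase j) (by simp)
      refine ⟨g'' * (g' * g), mul_mem hg'' (mul_mem hg' hg), fun c hc r => ?_⟩
      rw [mul_assoc, mul_assoc]
      rcases Finset.mem_insert.1 hc with rfl | hc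
      · by_cases hr : r = c
        · subst hr
          rw [h4, h1, one_apply_eq]
        · rw [h3 r (by simp [hr]), one_apply_ne hr]
      · rw [h5 r c (by rw [h2 c hc, one_apply_ne (ne_of_mem_of_not_mem hc hj).symm]), h2 c hc]
    generalize g * A = A at hs
    by_cases hlast : ∃ j', j' ≠ j ∧ j' ∉ s
    · obtain ⟨j', hj'j, hj's⟩ := hlast
      obtain ⟨g₁, hg₁, h1, h2, h3⟩ := exists_elementary_clear hR j A ((sᶜ).erase j)
        (Finset.notMem_erase j _)
      have hs₁ : ∀ c ∈ s, ∀ r, (g₁ * A) r c = (1 : Matrix ι ι R) r c := fun c hc r => by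
        have hjc : A j c = 0 := by rw [hs c hc, one_apply_ne (ne_of_mem_of_not_mem hc hj).symm]
        obtain ⟨h4, h5⟩ := h3 c hjc fun l hl => by
          simp only [Finset.mem_erase, Finset.mem_compl] at hl
          rw [hs c hc, one_apply_ne (ne_of_mem_of_not_mem hc hl.2).symm]
        by_cases hrj : r = j
        · subst hrj
          rw [h4, one_apply_ne (ne_of_mem_of_not_mem hc hj).symm]
        by_cases hrs : r ∈ s
        · rw [h2 r c hrj (by simp [hrs]), hs c hc]
        · rw [h5 r (by simp [hrj, hrs]), one_apply_ne (ne_of_mem_of_not_mem hc hrs).symm]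
      have hinv := mul_apply_eq_one_of_columns hj hs₁ fun r hr hrj => h1 r (by simp [hr, hrj])
      have hj'0 := h1 j' (by simp [hj'j, hj's])
      generalize hB : g₁ * A = B at hs₁ hinv hj'0
      refine ⟨transvection hj'j.symm (1 - B j j) * transvection hj'j (B⁻¹ j j) * g₁,
        mul_mem (mul_mem (transvection_mem_elementary _ _) (transvection_mem_elementary _ _)) hg₁,
        ?_, fun c hc r => ?_⟩
      · rw [mul_assoc, mul_assoc, hB, transvection_mul_apply, if_pos rfl, transvection_mul_apply,
          if_neg hj'j.symm, transvection_mul_apply, if_pos rfl, hj'0]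
        linear_combination (1 - B j j) * hinv
      · have hjc : B j c = 0 := by rw [hs₁ c hc, one_apply_ne (ne_of_mem_of_not_mem hc hj).symm]
        have hj'c : B j' c = 0 := by
          rw [hs₁ c hc, one_apply_ne (ne_of_mem_of_not_mem hc hj's).symm]
        rw [mul_assoc, mul_assoc, hB, transvection_mul_apply, transvection_mul_apply,
          transvection_mul_apply, if_pos rfl, hjc, hj'c, hs₁ c hc]
        simp
    · push Not at hlast
      refine ⟨1, one_mem _, ?_, by simpa using hs⟩
      have hA : (A : Matrix ι ι R) = (1 : Matrix ι ι R).updateCol j (fun r => A r j) := by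
        ext r c
        by_cases hc : c = j
        · subst hc; simp
        · rw [updateCol_ne hc, hs c (hlast c hc)]
      have := A.det_coe
      rw [hA, ← cramer_apply, cramer_one] at this
      simpa using this

theorem elementary_eq_top (hR : Function.Surjective (Int.castRingHom R)) :
    elementary ι R = ⊤ := by
  refine eq_top_iff.2 fun A _ => ?_
  obtain ⟨g, hg, h⟩ := exists_elementary_columns hR A Finset.univ
  have : g * A = 1 := by
    ext r c
    exact h c (Finset.mem_univ c) r
  rw [eq_inv_of_mul_eq_one_right this]
  exact inv_mem hg

end Elementary

lemma transvection_zpow {ι : Type*} [Fintype ι] [DecidableEq ι] {i j : ι} (hij : i ≠ j)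
    (a b : ℤ) : transvection hij a ^ b = transvection hij (a * b) := by
  induction b using Int.induction_on with
  | zero => simp
  | succ k ih => rw [_root_.zpow_add_one, ih, ← transvection_add]; ring_nf
  | pred k ih => rw [_root_.zpow_sub_one, ih, transvection_inv, ← transvection_add]; ring_nf

instance fg_int {ι : Type*} [Fintype ι] [DecidableEq ι] : Group.FG (SpecialLinearGroup ι ℤ) := by
  have hs : Function.Surjective (Int.castRingHom ℤ) := fun x => ⟨x, by simp⟩
  refine Group.fg_iff.2 ⟨Set.range fun p : {p : ι × ι // p.1 ≠ p.2} => transvection p.2 1, ?_,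
    Set.finite_range _⟩
  rw [eq_top_iff, ← elementary_eq_top hs, elementary, Subgroup.closure_le]
  rintro _ ⟨i, j, hij, b, rfl⟩
  rw [← one_mul b, ← transvection_zpow]
  exact zpow_mem (Subgroup.subset_closure (Set.mem_range_self
    (⟨(i, j), hij⟩ : {p : ι × ι // p.1 ≠ p.2}))) b

theorem map_intCast_surjective {ι : Type*} [Fintype ι] [DecidableEq ι] (q : ℕ) :
    Function.Surjective (map (n := ι) (Int.castRingHom (ZMod q))) := by
  rw [← MonoidHom.range_eq_top, eq_top_iff, ← elementary_eq_top ZMod.intCast_surjective,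
    elementary, Subgroup.closure_le]
  rintro _ ⟨i, j, hij, b, rfl⟩
  obtain ⟨a, rfl⟩ := ZMod.intCast_surjective b
  refine ⟨transvection hij a, ?_⟩
  ext r c
  change ((Matrix.transvection i j a r c : ℤ) : ZMod q) = Matrix.transvection i j (a : ZMod q) r c
  simp only [Matrix.transvection, Matrix.add_apply, Matrix.one_apply, Matrix.single_apply]
  split_ifs <;> simp

end Matrix.SpecialLinearGroup

lemma Nat.card_range_mul_card_ker {G H : Type*} [AddGroup G] [AddGroup H] (f : G →+ H)
    (hf : Function.Surjective f) : Nat.card H * Nat.card f.ker = Nat.card G := by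
  rw [mul_comm, ← AddSubgroup.card_mul_index f.ker, AddSubgroup.index_ker,
    AddMonoidHom.range_eq_top.2 hf, AddSubgroup.card_top]

/-- For a surjective homomorphism `f` of finite additive groups, a set containing the preimage
of `S` has density at least that of `S`. -/
lemma Nat.card_mul_card_le_of_preimage {G H : Type*} [AddGroup G] [AddGroup H] [Finite G]
    (f : G →+ H) (hf : Function.Surjective f) (S : Set H) (T : Set G)
    (hT : ∀ x, f x ∈ S → x ∈ T) : Nat.card S * Nat.card G ≤ Nat.card H * Nat.card T := by
  have h : Nat.card (f.ker × S) ≤ Nat.card T := by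
    refine Nat.card_le_card_of_injective
      (fun x : f.ker × S => (⟨x.1 + Function.surjInv hf x.2, hT _ (by
        rw [map_add, Function.surjInv_eq hf, x.1.2, zero_add]; exact x.2.2)⟩ : T)) ?_
    rintro ⟨⟨x, hx⟩, ⟨s, hs⟩⟩ ⟨⟨y, hy⟩, ⟨t, ht⟩⟩ hxy
    simp only [Subtype.mk.injEq] at hxy
    have hst := congrArg f hxy
    rw [map_add, map_add, Function.surjInv_eq hf, Function.surjInv_eq hf, hx, hy, zero_add,
      zero_add] at hst
    subst hst
    simpa using hxy
  rw [Nat.card_prod] at h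
  rw [← Nat.card_range_mul_card_ker f hf]
  calc _ = Nat.card H * (Nat.card f.ker * Nat.card S) := by ring
    _ ≤ _ := Nat.mul_le_mul_left _ h

lemma ZMod.isUnit_of_isUnit_castHom_pow {p k : ℕ} [NeZero (p ^ k)] (hk : k ≠ 0) {x : ZMod (p ^ k)}
    (hx : IsUnit (ZMod.castHom (dvd_pow_self p hk) (ZMod p) x)) : IsUnit x := by
  obtain ⟨a, rfl⟩ := ZMod.natCast_zmod_surjective (n := p ^ k) x
  rw [map_natCast] at hx
  rw [ZMod.isUnit_iff_coprime] at hx ⊢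
  exact hx.pow_right _

lemma Matrix.card_GL_ge (n p : ℕ) (hp : p.Prime) :
    p ^ (n * n) ≤ 2 ^ n * Nat.card (GL (Fin n) (ZMod p)) := by
  have := Fact.mk hp
  rw [Matrix.card_GL_field, ZMod.card, pow_mul, ← Fin.prod_const n (p ^ n),
    ← Fin.prod_const n 2, ← Finset.prod_mul_distrib]
  refine Finset.prod_le_prod' fun i _ => ?_
  have h1 : 2 * p ^ (i : ℕ) ≤ p ^ n := calc
    2 * p ^ (i : ℕ) ≤ p * p ^ (i : ℕ) := Nat.mul_le_mul_right _ hp.two_le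
    _ = p ^ (i + 1 : ℕ) := by ring
    _ ≤ p ^ n := Nat.pow_le_pow_right hp.pos i.2
  omega

lemma Matrix.card_GL_zmod_pow_ge (n p k : ℕ) (hp : p.Prime) (hk : k ≠ 0) :
    (p ^ k) ^ (n * n) ≤ 2 ^ n * Nat.card (GL (Fin n) (ZMod (p ^ k))) := by
  have : NeZero (p ^ k) := ⟨pow_ne_zero _ hp.ne_zero⟩
  have : NeZero p := ⟨hp.ne_zero⟩
  have card_units : ∀ (q : ℕ), Nat.card {A : Matrix (Fin n) (Fin n) (ZMod q) | IsUnit A} =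
      Nat.card (GL (Fin n) (ZMod q)) := fun q =>
    (Nat.card_congr (Equiv.ofBijective (fun u : GL (Fin n) (ZMod q) =>
      (⟨u.1, u.isUnit⟩ : {A : Matrix (Fin n) (Fin n) (ZMod q) | IsUnit A}))
      ⟨fun u v huv => Units.ext (congrArg Subtype.val huv),
        fun ⟨_, u, hu⟩ => ⟨u, Subtype.ext hu⟩⟩)).symm
  have card_mat : ∀ (q : ℕ), Nat.card (Matrix (Fin n) (Fin n) (ZMod q)) = q ^ (n * n) := fun q => by
    rw [Matrix, Nat.card_fun, Nat.card_fun, Nat.card_zmod, Nat.card_fin, ← pow_mul]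
  set φ := ZMod.castHom (dvd_pow_self p hk) (ZMod p) with hφ
  have h := Nat.card_mul_card_le_of_preimage
    (φ.mapMatrix (m := Fin n)).toAddMonoidHom
    (fun A => by
      obtain ⟨f, hf⟩ : ∃ f : ZMod p → ZMod (p ^ k), ∀ x, φ (f x) = x :=
        ⟨_, Function.surjInv_eq (ZMod.castHom_surjective _)⟩
      refine ⟨A.map f, ?_⟩
      ext i j
      exact hf _)
    {A | IsUnit A} {A | IsUnit A} (fun A hA => by
      simp only [Set.mem_ofPred_eq] at hA ⊢
      rw [Matrix.isUnit_iff_isUnit_det] at hA ⊢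
      apply ZMod.isUnit_of_isUnit_castHom_pow hk
      rw [← hφ, RingHom.map_det]
      exact hA)
  rw [card_units, card_units, card_mat, card_mat] at h
  have h2 := Matrix.card_GL_ge n p hp
  have h3 : 0 < p ^ (n * n) := pow_pos hp.pos _
  refine Nat.le_of_mul_le_mul_left (c := p ^ (n * n)) ?_ h3
  calc _ ≤ 2 ^ n * Nat.card (GL (Fin n) (ZMod p)) * (p ^ k) ^ (n * n) := Nat.mul_le_mul_right _ h2
    _ = 2 ^ n * (Nat.card (GL (Fin n) (ZMod p)) * (p ^ k) ^ (n * n)) := by ring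
    _ ≤ 2 ^ n * (p ^ (n * n) * Nat.card (GL (Fin n) (ZMod (p ^ k)))) := Nat.mul_le_mul_left _ h
    _ = _ := by ring

lemma Matrix.card_GL_le_card_SL_mul (n q : ℕ) [NeZero q] :
    Nat.card (GL (Fin n) (ZMod q)) ≤ Nat.card (SpecialLinearGroup (Fin n) (ZMod q)) * q := by
  set d : GL (Fin n) (ZMod q) →* (ZMod q)ˣ := GeneralLinearGroup.det
  rw [← Subgroup.card_mul_index d.ker, Subgroup.index_ker]
  refine Nat.mul_le_mul ?_ ?_
  · refine Nat.card_le_card_of_injective (fun g : d.ker =>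
      (⟨(g : GL (Fin n) (ZMod q)), ?_⟩ : SpecialLinearGroup (Fin n) (ZMod q))) ?_
    · exact congrArg Units.val g.2
    · intro g h hgh
      exact Subtype.ext (Units.ext (congrArg Subtype.val hgh))
  · calc Nat.card d.range ≤ Nat.card (ZMod q)ˣ := Subgroup.card_le_card_group _
      _ ≤ Nat.card (ZMod q) := Nat.card_le_card_of_injective _ Units.val_injective
      _ = q := Nat.card_zmod q

lemma Matrix.card_SL_zmod_pow_ge (n p k : ℕ) (hn : n ≠ 0) (hp : p.Prime) (hk : k ≠ 0) :
    (p ^ k) ^ (n ^ 2 - 1) ≤ 2 ^ n * Nat.card (SpecialLinearGroup (Fin n) (ZMod (p ^ k))) := by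
  have : NeZero (p ^ k) := ⟨pow_ne_zero _ hp.ne_zero⟩
  have hq : 0 < p ^ k := pow_pos hp.pos _
  refine Nat.le_of_mul_le_mul_right (c := p ^ k) ?_ hq
  rw [← pow_succ, Nat.sub_add_cancel (Nat.one_le_pow _ _ (Nat.pos_of_ne_zero hn)), sq, mul_assoc]
  exact (Matrix.card_GL_zmod_pow_ge n p k hp hk).trans
    (Nat.mul_le_mul_left _ (Matrix.card_GL_le_card_SL_mul n _))

section RootsOfUnity

/-- In a finite commutative group with a cyclic subgroup of index `m`, there are at most `n * m`
solutions of `x ^ n = 1`. -/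
lemma card_le_of_forall_pow_eq_one {G : Type*} [CommGroup G] [Finite G] (H K : Subgroup G)
    [IsCyclic H] {n : ℕ} (hn : 0 < n) (hK : ∀ x ∈ K, x ^ n = 1) :
    Nat.card K ≤ n * H.index := by
  classical
  have h1 : Nat.card (H.subgroupOf K) ≤ n := by
    cases nonempty_fintype G
    have : Fintype H := Fintype.ofFinite H
    refine le_trans ?_ (IsCyclic.card_pow_eq_one_le (α := H) hn)
    rw [← Fintype.card_coe, ← Nat.card_eq_fintype_card]
    refine Nat.card_le_card_of_injective
      (fun x : H.subgroupOf K => (⟨⟨x.1.1, x.2⟩, ?_⟩ : {a : H // a ∈ _})) ?_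
    · simp only [Finset.mem_filter, Finset.mem_univ, true_and]
      exact Subtype.ext (hK _ x.1.2)
    · intro x y hxy
      exact Subtype.ext (Subtype.ext (congrArg (fun z => (z.1.1 : G)) hxy))
  have h2 : H.relIndex K ≤ H.index :=
    Nat.le_of_dvd (Nat.pos_of_ne_zero Subgroup.FiniteIndex.index_ne_zero)
      (Subgroup.relIndex_dvd_index_of_normal H K)
  rw [← Subgroup.card_mul_index (H.subgroupOf K)]
  exact Nat.mul_le_mul h1 h2

lemma ZMod.exists_isCyclic_units_prime_pow (p k : ℕ) (hp : p.Prime) :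
    ∃ H : Subgroup (ZMod (p ^ k))ˣ, IsCyclic H ∧ H.index ≤ 2 := by
  by_cases hc : IsCyclic (ZMod (p ^ k))ˣ
  · exact ⟨⊤, isCyclic_of_surjective _ Subgroup.topEquiv.symm.surjective, by simp⟩
  · have hp2 : p = 2 := by
      by_contra h
      exact hc (ZMod.isCyclic_units_of_prime_pow p hp h k)
    subst hp2
    have hk : ¬ k ≤ 2 := fun h => hc ((ZMod.isCyclic_units_two_pow_iff k).2 h)
    obtain ⟨m, rfl⟩ : ∃ m, k = m + 2 := ⟨k - 2, by omega⟩
    have h5 : IsUnit (5 : ZMod (2 ^ (m + 2))) := by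
      have : IsUnit ((5 : ℕ) : ZMod (2 ^ (m + 2))) :=
        (ZMod.isUnit_iff_coprime _ _).2 (Nat.Coprime.pow_right _ (by decide))
      simpa using this
    obtain ⟨u, hu⟩ := h5
    refine ⟨Subgroup.zpowers u, inferInstance, ?_⟩
    have hord : orderOf u = 2 ^ m := by
      rw [← orderOf_units, hu, ZMod.orderOf_five]
    have h := Subgroup.card_mul_index (Subgroup.zpowers u)
    rw [Nat.card_zpowers, hord, Nat.card_eq_fintype_card, ZMod.card_units_eq_totient,
      Nat.totient_prime_pow hp (by omega)] at h
    have : 2 ^ m * (Subgroup.zpowers u).index = 2 ^ m * 2 := by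
      rw [h, show m + 2 - 1 = m + 1 from rfl]; ring
    exact (Nat.eq_of_mul_eq_mul_left (by positivity) this).le

lemma ZMod.card_rootsOfUnity_prime_pow_le (n p k : ℕ) (hp : p.Prime) (hn : 0 < n) :
    Nat.card (rootsOfUnity n (ZMod (p ^ k))) ≤ n * 2 := by
  have : NeZero (p ^ k) := ⟨pow_ne_zero _ hp.ne_zero⟩
  obtain ⟨H, hH, hi⟩ := ZMod.exists_isCyclic_units_prime_pow p k hp
  exact (card_le_of_forall_pow_eq_one H _ hn fun x hx => hx).trans (Nat.mul_le_mul_left _ hi)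

end RootsOfUnity

/-- The subgroup of integer matrices that are scalar modulo `p ^ k` has index at least a constant
times `(p ^ k) ^ (n ^ 2 - 1)`. -/
theorem Matrix.SpecialLinearGroup.index_comap_center_ge (n p k : ℕ) (hn : n ≠ 0) (hp : p.Prime) :
    (p ^ k) ^ (n ^ 2 - 1) ≤ 2 ^ n * (n * 2) * ((Subgroup.center
      (SpecialLinearGroup (Fin n) (ZMod (p ^ k)))).comap
        (map (Int.castRingHom (ZMod (p ^ k))))).index := by
  have : NeZero (p ^ k) := ⟨pow_ne_zero _ hp.ne_zero⟩
  rw [Subgroup.index_comap_of_surjective _ (map_intCast_surjective _)]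
  have hi : 0 < (Subgroup.center (SpecialLinearGroup (Fin n) (ZMod (p ^ k)))).index :=
    Nat.pos_of_ne_zero Subgroup.FiniteIndex.index_ne_zero
  by_cases hk : k = 0
  · subst hk
    rw [pow_zero, one_pow]
    exact Nat.mul_pos (by positivity) hi
  refine (Matrix.card_SL_zmod_pow_ge n p k hn hp hk).trans ?_
  rw [mul_assoc, ← Subgroup.card_mul_index
    (Subgroup.center (SpecialLinearGroup (Fin n) (ZMod (p ^ k))))]
  refine Nat.mul_le_mul_left _ (Nat.mul_le_mul_right _ ?_)
  have := ZMod.card_rootsOfUnity_prime_pow_le n p k hp (Nat.pos_of_ne_zero hn)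
  rwa [Nat.card_congr (center_equiv_rootsOfUnity' (⟨0, Nat.pos_of_ne_zero hn⟩ : Fin n)).toEquiv,
    Fintype.card_fin]

namespace Subgroup

/-- If a conjugate of `a` by a conjugate of `T` under `x ∈ N` commutes with `c`, then `N`, being
normal, contains the commutator of `T⁻¹ * a * T` and `c`. -/
lemma commutator_mem_of_commute_conj {G : Type*} [Group G] (N : Subgroup G) [N.Normal]
    {x T a c : G} (hx : x ∈ N)
    (h : Commute ((x * T * x⁻¹)⁻¹ * a * (x * T * x⁻¹)) c) :
    (T⁻¹ * a * T) * c * (T⁻¹ * a * T)⁻¹ * c⁻¹ ∈ N := by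
  rw [← QuotientGroup.eq_one_iff] at hx ⊢
  have h' := congrArg (QuotientGroup.mk : G → G ⧸ N) h.eq
  simp only [QuotientGroup.mk_mul, QuotientGroup.mk_inv, hx, one_mul, inv_one, mul_one] at h' ⊢
  rw [h']
  group

lemma commutator_mem_of_commute_conj_of_le {G : Type*} [Group G] {D M : Subgroup G} (hMD : M ≤ D)
    (hM : (M.subgroupOf D).Normal) {x T a c : G} (hx : x ∈ M) (hT : T ∈ D) (ha : a ∈ D)
    (hc : c ∈ D) (h : Commute ((x * T * x⁻¹)⁻¹ * a * (x * T * x⁻¹)) c) :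
    (T⁻¹ * a * T) * c * (T⁻¹ * a * T)⁻¹ * c⁻¹ ∈ M :=
  (M.subgroupOf D).commutator_mem_of_commute_conj (x := ⟨x, hMD hx⟩) (T := ⟨T, hT⟩) (a := ⟨a, ha⟩)
    (c := ⟨c, hc⟩) hx (Subtype.ext h)

lemma conj_mem_of_normal_subgroupOf {G : Type*} [Group G] {D M : Subgroup G} (hMD : M ≤ D)
    (hM : (M.subgroupOf D).Normal) {x g : G} (hx : x ∈ M) (hg : g ∈ D) : g * x * g⁻¹ ∈ M :=
  hM.conj_mem ⟨x, hMD hx⟩ hx ⟨g, hg⟩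

end Subgroup

namespace Matrix.SpecialLinearGroup

variable {ι : Type*} [Fintype ι] [DecidableEq ι]

section CommRing

variable {R : Type*} [CommRing R]

lemma coe_transvection' {i j : ι} (hij : i ≠ j) (b : R) :
    (transvection hij b : Matrix ι ι R) = 1 + single i j b := rfl

lemma inv_transvection {i j : ι} (hij : i ≠ j) (b : R) :
    (transvection hij b)⁻¹ = transvection hij (-b) := by
  rw [inv_eq_iff_mul_eq_one]
  refine Subtype.ext ?_
  simp only [coe_mul, coe_transvection', add_mul, mul_add, one_mul, mul_one,
    single_mul_single_of_ne _ _ _ _ hij.symm, add_zero, add_assoc, ← single_add, add_neg_cancel,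
    single_zero, coe_one]

lemma transvection_commutator {i j k : ι} (hij : i ≠ j) (hjk : j ≠ k) (hik : i ≠ k) (a b : R) :
    transvection hij a * transvection hjk b * (transvection hij a)⁻¹ * (transvection hjk b)⁻¹ =
      transvection hik (a * b) := by
  rw [mul_inv_eq_iff_eq_mul, mul_inv_eq_iff_eq_mul]
  refine Subtype.ext ?_
  simp only [coe_mul, coe_transvection', mul_add, add_mul, one_mul, mul_one,
    single_mul_single_same, single_mul_single_of_ne _ _ _ _ hik.symm,
    single_mul_single_of_ne _ _ _ _ hjk.symm, zero_mul]
  abel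

/-- The conjugate of `transvection hji a` by an element whose `i`-th row is `e i` commutes with
every transvection supported in the same column. -/
lemma commute_conj_transvection {i j k : ι} (hji : j ≠ i) (hki : k ≠ i) (a c : R)
    (S : SpecialLinearGroup ι R)
    (hS : single i i 1 * (S : Matrix ι ι R) = single i i 1) :
    Commute (S⁻¹ * transvection hji a * S) (transvection hki c) := by
  have hinv : (S⁻¹ : SpecialLinearGroup ι R).1 * S.1 = 1 := by
    rw [← coe_mul, inv_mul_cancel, coe_one]
  have hinv' : S.1 * (S⁻¹ : SpecialLinearGroup ι R).1 = 1 := by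
    rw [← coe_mul, mul_inv_cancel, coe_one]
  have hS' : single i i 1 * (S⁻¹ : SpecialLinearGroup ι R).1 = single i i 1 := by
    conv_lhs => rw [← hS, mul_assoc, hinv', mul_one]
  have key : ∀ (l : ι) (b : R), single l i b = single l i b * single i i (1 : R) := fun l b => by
    rw [single_mul_single_same, mul_one]
  have h1 : single j i a * S.1 = single j i a := by
    rw [key, mul_assoc, hS]
  have h2 : single k i c * (S⁻¹ : SpecialLinearGroup ι R).1 = single k i c := by
    rw [key, mul_assoc, hS']
  have hp : (S⁻¹ * transvection hji a * S : SpecialLinearGroup ι R).1 =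
      1 + (S⁻¹ : SpecialLinearGroup ι R).1 * single j i a := by
    rw [coe_mul, coe_mul, coe_transvection', mul_add, mul_one, add_mul, hinv, mul_assoc, h1]
  refine Subtype.ext ?_
  change _ * _ = _ * _
  have h3 : (S⁻¹ : SpecialLinearGroup ι R).1 * single j i a * single k i c = 0 := by
    rw [mul_assoc, single_mul_single_of_ne _ _ _ _ hki.symm, mul_zero]
  have h4 : single k i c * ((S⁻¹ : SpecialLinearGroup ι R).1 * single j i a) = 0 := by
    rw [← mul_assoc, h2, single_mul_single_of_ne _ _ _ _ hji.symm]
  rw [hp, coe_transvection']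
  simp only [add_mul, mul_add, mul_one, one_mul, h3, h4, add_zero]
  abel

lemma conj_transvection_mul {i j k : ι} (hij : i ≠ j) (hik : i ≠ k) (hjk : j ≠ k) (a b c : R) :
    (transvection hik b * transvection hjk c)⁻¹ * transvection hij.symm a *
      (transvection hik b * transvection hjk c) =
    transvection hij.symm a * transvection hjk (a * b) := by
  rw [mul_assoc, inv_mul_eq_iff_eq_mul]
  refine Subtype.ext ?_
  simp only [coe_mul, coe_transvection', mul_add, add_mul, one_mul, mul_one,
    single_mul_single_same, single_mul_single_of_ne _ _ _ _ hjk.symm,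
    single_mul_single_of_ne _ _ _ _ hij, add_zero]
  abel

lemma transvection_mul_commutator {i j k : ι} (hij : i ≠ j) (hik : i ≠ k) (hjk : j ≠ k)
    (a b c : R) :
    transvection hij.symm a * transvection hjk b * transvection hik.symm c *
      (transvection hij.symm a * transvection hjk b)⁻¹ * (transvection hik.symm c)⁻¹ =
    transvection hij.symm (b * c) := by
  rw [mul_inv_eq_iff_eq_mul, mul_inv_eq_iff_eq_mul]
  refine Subtype.ext ?_
  simp only [coe_mul, coe_transvection', mul_add, add_mul, one_mul, mul_one,
    single_mul_single_same, single_mul_single_of_ne _ _ _ _ hik,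
    single_mul_single_of_ne _ _ _ _ hij, add_zero]
  abel

lemma single_mul_conj {i j k : ι} (hij : i ≠ j) (hik : i ≠ k) (hjk : j ≠ k) (a : R)
    (x : SpecialLinearGroup ι R) :
    single i i 1 * (x * (transvection hik (a * x i j) * transvection hjk (-(a * x i i))) *
      x⁻¹ : SpecialLinearGroup ι R).1 = single i i 1 := by
  have h0 : (transvection hik (a * x i j) * transvection hjk (-(a * x i i)) :
      SpecialLinearGroup ι R).1 = 1 + (single i k (a * x i j) + single j k (-(a * x i i))) := by
    simp only [coe_mul, coe_transvection', mul_add, add_mul, one_mul, mul_one,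
      single_mul_single_of_ne _ _ _ _ hjk.symm, add_zero]
    abel
  have h1 : single i i 1 * (x.1 * (single i k (a * x i j) + single j k (-(a * x i i)))) = 0 := by
    ext l m
    by_cases hl : l = i
    · subst hl
      rw [single_mul_apply_same, one_mul, mul_add]
      by_cases hm : m = k
      · subst hm
        rw [add_apply, mul_single_apply_same, mul_single_apply_same]
        simp only [zero_apply]
        ring
      · rw [add_apply, mul_single_apply_of_ne _ _ _ _ _ hm, mul_single_apply_of_ne _ _ _ _ _ hm]
        simp
    · rw [single_mul_apply_of_ne _ _ _ _ _ hl]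
      rfl
  rw [coe_mul, coe_mul, h0, mul_add, mul_one, add_mul, mul_add, ← mul_assoc (single i i 1) (_ * _),
    h1, zero_mul, add_zero, ← coe_mul, mul_inv_cancel, coe_one, mul_one]

end CommRing

section NormalSubgroup

variable {D M : Subgroup (SpecialLinearGroup ι ℤ)} {f : ℤ}

/-- The integers `a` such that all transvections with parameter `a` belong to `M`. -/
def transvectionLevel (M : Subgroup (SpecialLinearGroup ι ℤ)) : AddSubgroup ℤ where
  carrier := {a | ∀ (i j : ι) (hij : i ≠ j), transvection hij a ∈ M}
  add_mem' := fun {a b} ha hb i j hij => by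
    have h := M.mul_mem (ha i j hij) (hb i j hij)
    rwa [← one_mul a, ← one_mul b, ← transvection_zpow, ← transvection_zpow, ← _root_.zpow_add,
      transvection_zpow, one_mul] at h
  zero_mem' := fun i j hij => by
    have h := transvection_zpow hij 0 0
    rw [zpow_zero, zero_mul] at h
    rw [← h]
    exact M.one_mem
  neg_mem' := fun {a} ha i j hij => by
    rw [← inv_transvection]
    exact M.inv_mem (ha i j hij)

lemma transvection_mul_mem {i j : ι} (hij : i ≠ j) {a : ℤ} (h : transvection hij a ∈ M) (b : ℤ) :
    transvection hij (b * a) ∈ M := by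
  rw [mul_comm, ← transvection_zpow]
  exact M.zpow_mem h b

lemma transvection_mem_of_mem_normal (hMD : M ≤ D) (hM : (M.subgroupOf D).Normal)
    (hf : ∀ (i j : ι) (hij : i ≠ j) (a : ℤ), transvection hij (f * a) ∈ D)
    (x : SpecialLinearGroup ι ℤ) (hx : x ∈ M) {i j k : ι} (hij : i ≠ j) (hik : i ≠ k)
    (hjk : j ≠ k) : transvection hij.symm (f ^ 3 * x i j) ∈ M := by
  have h := Subgroup.commutator_mem_of_commute_conj_of_le hMD hM hx
    (T := transvection hik (f * x i j) * transvection hjk (-(f * x i i)))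
    (a := transvection hij.symm f) (c := transvection hik.symm f)
    (D.mul_mem (hf _ _ _ _) (by simpa using hf _ _ hjk (-x i i))) (by simpa using hf _ _ hij.symm 1)
    (by simpa using hf _ _ hik.symm 1)
    (commute_conj_transvection hij.symm hik.symm f f _ (single_mul_conj hij hik hjk _ _))
  rw [conj_transvection_mul hij hik hjk, transvection_mul_commutator hij hik hjk] at h
  rwa [show f ^ 3 * x i j = f * (f * x i j) * f by ring]

lemma transvection_mem_row (hMD : M ≤ D) (hM : (M.subgroupOf D).Normal)
    (hf : ∀ (i j : ι) (hij : i ≠ j) (a : ℤ), transvection hij (f * a) ∈ D) {i j k : ι}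
    (hij : i ≠ j) (hik : i ≠ k) (hjk : j ≠ k) {a : ℤ} (h : transvection hij a ∈ M) :
    transvection hik (f * a) ∈ M := by
  have h1 := M.mul_mem h (Subgroup.conj_mem_of_normal_subgroupOf hMD hM (M.inv_mem h)
    (hf j k hjk 1))
  rw [← mul_assoc, ← mul_assoc, transvection_commutator hij hjk hik] at h1
  convert h1 using 2
  ring

lemma transvection_mem_col (hMD : M ≤ D) (hM : (M.subgroupOf D).Normal)
    (hf : ∀ (i j : ι) (hij : i ≠ j) (a : ℤ), transvection hij (f * a) ∈ D) {i j k : ι}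
    (hij : i ≠ j) (hik : i ≠ k) (hjk : j ≠ k) {a : ℤ} (h : transvection hjk a ∈ M) :
    transvection hik (f * a) ∈ M := by
  have h1 := M.mul_mem (Subgroup.conj_mem_of_normal_subgroupOf hMD hM h (hf i j hij 1))
    (M.inv_mem h)
  rw [transvection_commutator hij hjk hik] at h1
  convert h1 using 2
  ring

lemma mem_transvectionLevel_of_transvection_mem (h3 : ∀ i j : ι, ∃ k, i ≠ k ∧ j ≠ k) (hMD : M ≤ D)
    (hM : (M.subgroupOf D).Normal)
    (hf : ∀ (i j : ι) (hij : i ≠ j) (a : ℤ), transvection hij (f * a) ∈ D) {i j : ι}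
    (hij : i ≠ j) {a : ℤ} (h : transvection hij a ∈ M) :
    f ^ 3 * a ∈ transvectionLevel M := by
  intro k l hkl
  have row : ∀ {i j k : ι} {a : ℤ} (hij : i ≠ j) (hik : i ≠ k), j ≠ k →
      transvection hij a ∈ M → transvection hik (f * a) ∈ M := fun hij hik hjk h =>
    transvection_mem_row hMD hM hf hij hik hjk h
  have col : ∀ {i j k : ι} {a : ℤ} (hjk : j ≠ k) (hik : i ≠ k), i ≠ j →
      transvection hjk a ∈ M → transvection hik (f * a) ∈ M := fun hjk hik hij h =>
    transvection_mem_col hMD hM hf hij hik hjk h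
  by_cases hki : k = i
  · subst hki
    by_cases hlj : l = j
    · subst hlj
      exact transvection_mul_mem hkl h _
    · rw [show f ^ 3 * a = f ^ 2 * (f * a) by ring]
      exact transvection_mul_mem _ (row hij hkl (Ne.symm hlj) h) _
  by_cases hlj : l = j
  · subst hlj
    rw [show f ^ 3 * a = f ^ 2 * (f * a) by ring]
    exact transvection_mul_mem _ (col hij hkl hki h) _
  by_cases hli : l = i
  · subst hli
    by_cases hkj : k = j
    · subst hkj
      obtain ⟨m, hlm, hkm⟩ := h3 l k
      rw [show f ^ 3 * a = f * (f * (f * a)) by ring]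
      exact row hkm hkl hlm.symm (col hlm hkm hkl (row hij hlm hkm h))
    · rw [show f ^ 3 * a = f * (f * (f * a)) by ring]
      exact transvection_mul_mem _ (row hkj hkl (Ne.symm hlj) (col hij hkj hki h)) _
  · rw [show f ^ 3 * a = f * (f * (f * a)) by ring]
    exact transvection_mul_mem _ (col (Ne.symm hli) hkl hki (row hij (Ne.symm hli) (Ne.symm hlj) h)) _

lemma offDiag_mem_transvectionLevel (h3 : ∀ i j : ι, ∃ k, i ≠ k ∧ j ≠ k) (hMD : M ≤ D)
    (hM : (M.subgroupOf D).Normal)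
    (hf : ∀ (i j : ι) (hij : i ≠ j) (a : ℤ), transvection hij (f * a) ∈ D)
    (x : SpecialLinearGroup ι ℤ) (hx : x ∈ M) {i j : ι} (hij : i ≠ j) :
    f ^ 6 * x i j ∈ transvectionLevel M := by
  obtain ⟨k, hik, hjk⟩ := h3 i j
  rw [show f ^ 6 * x i j = f ^ 3 * (f ^ 3 * x i j) by ring]
  exact mem_transvectionLevel_of_transvection_mem h3 hMD hM hf _
    (transvection_mem_of_mem_normal hMD hM hf x hx hij hik hjk)

lemma diag_sub_mem_transvectionLevel (h3 : ∀ i j : ι, ∃ k, i ≠ k ∧ j ≠ k) (hMD : M ≤ D)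
    (hM : (M.subgroupOf D).Normal)
    (hf : ∀ (i j : ι) (hij : i ≠ j) (a : ℤ), transvection hij (f * a) ∈ D)
    (x : SpecialLinearGroup ι ℤ) (hx : x ∈ M) {i j : ι} (hij : i ≠ j) :
    f ^ 7 * (x j j - x i i) ∈ transvectionLevel M := by
  set y := transvection hij (f * 1) * x * (transvection hij (f * 1))⁻¹
  have hy : y ∈ M := Subgroup.conj_mem_of_normal_subgroupOf hMD hM hx (hf i j hij 1)
  have hyij : y i j = x i j + f * x j j - f * (x i i + f * x j i) := by
    have h : y * transvection hij (f * 1) = transvection hij (f * 1) * x := inv_mul_cancel_right _ _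
    have h1 := congrArg (fun z : SpecialLinearGroup ι ℤ => z i j) h
    have h2 := congrArg (fun z : SpecialLinearGroup ι ℤ => z i i) h
    simp only [transvection_mul_apply, if_true] at h1 h2
    rw [coe_mul, coe_transvection', mul_add, add_apply, mul_single_apply_same, mul_one] at h1
    rw [coe_mul, coe_transvection', mul_add, add_apply, mul_single_apply_of_ne _ _ _ _ _ hij,
      mul_one] at h2
    linear_combination h1 - f * h2
  have e := offDiag_mem_transvectionLevel h3 hMD hM hf
  have h := (transvectionLevel M).add_mem ((transvectionLevel M).sub_mem (e y hy hij) (e x hx hij))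
    ((transvectionLevel M).zsmul_mem (e x hx hij.symm) (f ^ 2))
  rw [hyij, smul_eq_mul] at h
  convert h using 1
  ring

lemma transvectionLevel_ne_bot [M.FiniteIndex] : transvectionLevel M ≠ ⊥ := by
  intro h
  have : (M.index.factorial : ℤ) ∈ transvectionLevel M := by
    intro i j hij
    obtain ⟨n, hn0, hn, hmem⟩ := M.exists_pow_mem_of_index_ne_zero M.index_ne_zero_of_finite
      (transvection hij 1)
    obtain ⟨c, hc⟩ := Nat.dvd_factorial hn0 hn
    have h1 := M.pow_mem hmem c
    rw [← pow_mul, ← hc, ← zpow_natCast, transvection_zpow, one_mul] at h1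
    exact h1
  rw [h, AddSubgroup.mem_bot] at this
  exact Nat.factorial_ne_zero _ (by exact_mod_cast this)

lemma exists_prime_pow_dvd_of_not_mem_transvectionLevel [M.FiniteIndex] {m c : ℕ} {a : ℤ}
    (ha : a * Nat.lcmUpto m ∉ transvectionLevel M) (hc : c ≠ 0) :
    ∃ p k : ℕ, p.Prime ∧ m < p ^ k * c ∧
      ∀ z : ℤ, c * z ∈ transvectionLevel M → ((p ^ k : ℕ) : ℤ) ∣ z := by
  obtain ⟨r, hr⟩ := Int.subgroup_cyclic (transvectionLevel M)
  have hr0 : r ≠ 0 := by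
    rintro rfl
    exact transvectionLevel_ne_bot (M := M) (by rw [hr]; simp)
  have hmem : ∀ z : ℤ, z ∈ transvectionLevel M ↔ r.natAbs ∣ z.natAbs := fun z => by
    rw [hr, AddSubgroup.mem_closure_singleton, Int.natAbs_dvd_natAbs]
    simp only [smul_eq_mul, dvd_def, eq_comm, mul_comm]
  have hL : Nat.lcmUpto m ∣ (a * Nat.lcmUpto m).natAbs := by
    rw [Int.natAbs_mul, Int.natAbs_natCast]
    exact dvd_mul_left _ _
  rw [hmem] at ha
  have hA0 : (a * Nat.lcmUpto m).natAbs ≠ 0 := fun h => ha (h ▸ dvd_zero _)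
  have hL0 := Nat.lcmUpto_ne_zero m
  obtain ⟨p, hp, hlt⟩ : ∃ p, p.Prime ∧
      (a * Nat.lcmUpto m).natAbs.factorization p < r.natAbs.factorization p := by
    by_contra! h
    exact ha ((Nat.factorization_prime_le_iff_dvd (Int.natAbs_ne_zero.2 hr0) hA0).1 h)
  have hlog : p.log m < r.natAbs.factorization p := by
    rw [← Nat.factorization_lcmUpto _ hp]
    exact lt_of_le_of_lt ((Nat.factorization_le_iff_dvd hL0 hA0).2 hL p) hlt
  have hcp : p ^ c.factorization p * (c / p ^ c.factorization p) = c :=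
    Nat.ordProj_mul_ordCompl_eq_self c p
  have hm : m < p ^ r.natAbs.factorization p :=
    (Nat.lt_pow_succ_log_self hp.one_lt m).trans_le (Nat.pow_le_pow_right hp.pos hlog)
  refine ⟨p, r.natAbs.factorization p - c.factorization p, hp, ?_, fun z hz => ?_⟩
  · calc m < p ^ r.natAbs.factorization p := hm
      _ ≤ p ^ (r.natAbs.factorization p - c.factorization p + c.factorization p) :=
        Nat.pow_le_pow_right hp.pos (by omega)
      _ = p ^ (r.natAbs.factorization p - c.factorization p) * p ^ c.factorization p := pow_add _ _ _
      _ ≤ _ := Nat.mul_le_mul_left _ (Nat.ordProj_le p hc)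
  · rw [Int.natCast_dvd]
    rcases le_total (r.natAbs.factorization p) (c.factorization p) with h | h
    · rw [Nat.sub_eq_zero_of_le h, pow_zero]
      exact one_dvd _
    rw [hmem, Int.natAbs_mul, Int.natAbs_natCast] at hz
    have h1 := (Nat.ordProj_dvd r.natAbs p).trans hz
    rw [← Nat.sub_add_cancel h, pow_add] at h1
    nth_rw 3 [← hcp] at h1
    rw [mul_comm (p ^ (_ - _)), mul_assoc] at h1
    exact ((Nat.coprime_ordCompl hp hc).pow_left _).dvd_of_dvd_mul_left
      (Nat.dvd_of_mul_dvd_mul_left (pow_pos hp.pos _) h1)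

lemma le_comap_center_of_forall_dvd {q : ℕ} (i₀ : ι)
    (hij : ∀ x ∈ M, ∀ i j, i ≠ j → (q : ℤ) ∣ x.1 i j)
    (hii : ∀ x ∈ M, ∀ i j, i ≠ j → (q : ℤ) ∣ x.1 j j - x.1 i i) :
    M ≤ (Subgroup.center (SpecialLinearGroup ι (ZMod q))).comap
      (map (Int.castRingHom (ZMod q))) := by
  intro x hx
  rw [Subgroup.mem_comap, mem_center_iff]
  have h : scalar ι ((x i₀ i₀ : ℤ) : ZMod q) = (map (Int.castRingHom (ZMod q)) x).1 := by
    ext i j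
    rw [scalar_apply]
    by_cases h : i = j
    · subst h
      rw [diagonal_apply_eq]
      by_cases h0 : i = i₀
      · subst h0; rfl
      · have := (ZMod.intCast_zmod_eq_zero_iff_dvd _ _).2 (hii x hx i i₀ h0)
        rw [Int.cast_sub, sub_eq_zero] at this
        exact this
    · rw [diagonal_apply_ne _ h]
      exact ((ZMod.intCast_zmod_eq_zero_iff_dvd _ _).2 (hij x hx i j h)).symm
  refine ⟨_, ?_, h⟩
  have h1 := congrArg det h
  rwa [scalar_apply, det_diagonal, Finset.prod_const, Finset.card_univ, (map _ x).2] at h1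

end NormalSubgroup

/-- Lower bound for the index of a normal subgroup of `D` omitting a transvection with a highly
divisible parameter. -/
theorem pow_le_index_of_transvection_notMem {n : ℕ} (hn : 3 ≤ n)
    {D : Subgroup (SpecialLinearGroup (Fin n) ℤ)} [D.FiniteIndex] {f : ℕ} (hf0 : f ≠ 0)
    (hf : ∀ (i j : Fin n) (hij : i ≠ j) (a : ℤ), transvection hij (f * a) ∈ D)
    (N : Subgroup D) [hN : N.Normal] [N.FiniteIndex] {m : ℕ} {i j : Fin n} (hij : i ≠ j)
    (hmem : (⟨transvection hij (f * (Nat.lcmUpto m : ℤ)), hf i j hij _⟩ : D) ∉ N) :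
    m ^ (n ^ 2 - 1) ≤
      (2 ^ n * (n * 2) * D.index * (f ^ 7) ^ (n ^ 2 - 1)) * N.index := by
  set M := N.map D.subtype with hMdef
  have hMD : M ≤ D := Subgroup.map_subtype_le N
  have hMN : M.subgroupOf D = N := by
    rw [Subgroup.subgroupOf, hMdef, Subgroup.comap_map_eq_self_of_injective D.subtype_injective]
  have hM : (M.subgroupOf D).Normal := by rwa [hMN]
  have hidx : M.index = N.index * D.index := Subgroup.index_map_subtype N
  have : M.FiniteIndex := ⟨by
    rw [hidx]
    exact mul_ne_zero N.index_ne_zero_of_finite D.index_ne_zero_of_finite⟩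
  have h3 : ∀ i j : Fin n, ∃ k, i ≠ k ∧ j ≠ k := fun i j => by
    obtain ⟨k, hk⟩ := Finset.exists_mem_notMem_of_card_lt_card (s := {i, j}) (t := Finset.univ)
      (Finset.card_le_two.trans_lt (by rw [Finset.card_univ, Fintype.card_fin]; omega))
    simp only [Finset.mem_insert, Finset.mem_singleton, not_or, ← ne_eq] at hk
    exact ⟨k, hk.2.1.symm, hk.2.2.symm⟩
  have hlevel : (f : ℤ) * Nat.lcmUpto m ∉ transvectionLevel M := fun h => by
    have h1 := h i j hij
    rw [← hMN] at hmem
    exact hmem h1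
  obtain ⟨p, k, hp, hlt, hdvd⟩ := exists_prime_pow_dvd_of_not_mem_transvectionLevel hlevel
    (pow_ne_zero 7 hf0)
  have hle := le_comap_center_of_forall_dvd (M := M) (q := p ^ k) i
    (fun x hx i j hij => hdvd _ (by
      have h1 := (transvectionLevel M).zsmul_mem
        (offDiag_mem_transvectionLevel h3 hMD hM hf x hx hij) f
      rw [smul_eq_mul, ← mul_assoc, ← pow_succ'] at h1
      exact_mod_cast h1))
    (fun x hx i j hij => hdvd _ (by
      have h1 := diag_sub_mem_transvectionLevel h3 hMD hM hf x hx hij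
      exact_mod_cast h1))
  have hB := index_comap_center_ge n p k (by omega) hp
  have hI := Nat.le_of_dvd (Nat.pos_of_ne_zero M.index_ne_zero_of_finite)
    (Subgroup.index_dvd_of_le hle)
  rw [hidx] at hI
  calc m ^ (n ^ 2 - 1) ≤ (p ^ k * f ^ 7) ^ (n ^ 2 - 1) := Nat.pow_le_pow_left hlt.le _
    _ = (p ^ k) ^ (n ^ 2 - 1) * (f ^ 7) ^ (n ^ 2 - 1) := mul_pow _ _ _
    _ ≤ 2 ^ n * (n * 2) * (N.index * D.index) * (f ^ 7) ^ (n ^ 2 - 1) :=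
      Nat.mul_le_mul_right _ (hB.trans (Nat.mul_le_mul_left _ hI))
    _ = _ := by ring

end Matrix.SpecialLinearGroup

section WordLength

variable {G : Type*} [Group G] {X : Set G}

lemma wordLength_le_length {l : List G} (hl : ∀ x ∈ l, x ∈ X ∨ x⁻¹ ∈ X) :
    wordLength X l.prod ≤ l.length :=
  Nat.sInf_le ⟨l, rfl, hl, rfl⟩

lemma exists_list_length_eq_wordLength (hX : Subgroup.closure X = ⊤) (g : G) :
    ∃ l : List G, l.length = wordLength X g ∧ (∀ x ∈ l, x ∈ X ∨ x⁻¹ ∈ X) ∧ l.prod = g := by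
  refine Nat.sInf_mem
    (s := {n | ∃ l : List G, l.length = n ∧ (∀ x ∈ l, x ∈ X ∨ x⁻¹ ∈ X) ∧ l.prod = g}) ?_
  obtain ⟨l, hl, hg⟩ := Submonoid.exists_list_of_mem_closure
    (show g ∈ Submonoid.closure (X ∪ X⁻¹) by
      rw [← Subgroup.closure_toSubmonoid, hX]
      exact Submonoid.mem_top g)
  exact ⟨l.length, l, rfl, hl, hg⟩

lemma wordLength_one (X : Set G) : wordLength X 1 = 0 :=
  Nat.le_zero.1 (wordLength_le_length (l := []) (by simp))

lemma wordLength_mul_le (hX : Subgroup.closure X = ⊤) (g h : G) :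
    wordLength X (g * h) ≤ wordLength X g + wordLength X h := by
  obtain ⟨l, hl, hlX, rfl⟩ := exists_list_length_eq_wordLength hX g
  obtain ⟨l', hl', hlX', rfl⟩ := exists_list_length_eq_wordLength hX h
  rw [← hl, ← hl', ← List.length_append, ← List.prod_append]
  refine wordLength_le_length fun x hx => ?_
  rcases List.mem_append.1 hx with h | h
  exacts [hlX x h, hlX' x h]

lemma wordLength_inv_le (hX : Subgroup.closure X = ⊤) (g : G) :
    wordLength X g⁻¹ ≤ wordLength X g := by
  obtain ⟨l, hl, hlX, rfl⟩ := exists_list_length_eq_wordLength hX g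
  rw [← hl, List.prod_inv_reverse]
  refine (wordLength_le_length fun x hx => ?_).trans (by simp)
  simp only [List.mem_reverse, List.mem_map] at hx
  obtain ⟨y, hy, rfl⟩ := hx
  rw [inv_inv]
  exact (hlX y hy).symm

lemma wordLength_pow_le (hX : Subgroup.closure X = ⊤) (g : G) (k : ℕ) :
    wordLength X (g ^ k) ≤ k * wordLength X g := by
  induction k with
  | zero => rw [pow_zero, wordLength_one, zero_mul]
  | succ k ih =>
    rw [pow_succ, add_mul, one_mul]
    exact (wordLength_mul_le hX _ _).trans (Nat.add_le_add_right ih _)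

lemma finite_setOf_wordLength_le (hXf : X.Finite) (hX : Subgroup.closure X = ⊤) (n : ℕ) :
    {g : G | wordLength X g ≤ n}.Finite := by
  have hfin : (X ∪ X⁻¹).Finite := hXf.union hXf.inv
  have := hfin.to_subtype
  refine ((List.finite_length_le (X ∪ X⁻¹ : Set G) n).image
    (fun l => (l.map Subtype.val).prod)).subset fun g hg => ?_
  obtain ⟨l, hl, hlX, rfl⟩ := exists_list_length_eq_wordLength hX g
  have hlX' : ∀ x ∈ l, x ∈ X ∪ X⁻¹ := hlX
  lift l to List (X ∪ X⁻¹ : Set G) using hlX'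
  refine ⟨l, ?_, rfl⟩
  rw [List.length_map] at hl
  exact hl.trans_le hg

end WordLength

section Distortion

/-- The sequence of traces of the powers of a matrix of determinant one and trace `t`. -/
def traceSeq (t : ℤ) : ℕ → ℤ
  | 0 => 2
  | 1 => t
  | k + 2 => t * traceSeq t (k + 1) - traceSeq t k

lemma pow_add_pow_eq_traceSeq {R : Type*} [Ring R] {s u : R} {t : ℤ} (hsu : s * u = 1)
    (hus : u * s = 1) (ht : s + u = t) (k : ℕ) : s ^ k + u ^ k = traceSeq t k := by
  induction k using Nat.twoStepInduction with
  | zero => norm_num [traceSeq]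
  | one => simpa [traceSeq] using ht
  | more k h0 h1 =>
    rw [traceSeq, Int.cast_sub, Int.cast_mul, ← h0, ← h1, ← ht, add_mul, mul_add, mul_add,
      ← pow_succ', ← pow_succ', pow_succ' u k, pow_succ' s k, ← mul_assoc, ← mul_assoc, hsu, hus]
    noncomm_ring

lemma traceSeq_pos_and_two_mul_le {t : ℤ} (ht : 4 ≤ t) (k : ℕ) :
    0 < traceSeq t k ∧ 2 * traceSeq t k ≤ traceSeq t (k + 1) := by
  induction k with
  | zero => simp only [traceSeq]; omega
  | succ k ih =>
    refine ⟨by omega, ?_⟩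
    rw [traceSeq]
    nlinarith

lemma two_pow_le_traceSeq {t : ℤ} (ht : 4 ≤ t) (k : ℕ) : 2 ^ k ≤ traceSeq t k := by
  induction k with
  | zero => simp [traceSeq]
  | succ k ih =>
    rw [pow_succ']
    linarith [(traceSeq_pos_and_two_mul_le ht k).2]

lemma traceSeq_succ_le {t : ℤ} (ht : 4 ≤ t) (k : ℕ) :
    traceSeq t (k + 1) ≤ t * traceSeq t k := by
  cases k with
  | zero => simp only [traceSeq]; omega
  | succ k =>
    rw [traceSeq]
    linarith [(traceSeq_pos_and_two_mul_le ht k).1]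

variable {G A : Type*} [Group G] [AddCommGroup A]

lemma pow_mul_map_eq {v : A → G} {σ : AddMonoid.End A} {b : G}
    (h : ∀ a, b * v a = v (σ a) * b) (k : ℕ) (a : A) : b ^ k * v a = v ((σ ^ k) a) * b ^ k := by
  induction k generalizing a with
  | zero => simp
  | succ k ih =>
    rw [pow_succ, mul_assoc, h, ← mul_assoc, ih, mul_assoc, pow_succ]
    rfl

/-- In a group containing an abelian group on which `b` acts with trace `t ≥ 4`, multiples of an
element of the abelian group are exponentially distorted. -/
theorem exists_wordLength_map_nsmul_le {X : Set G} (hX : Subgroup.closure X = ⊤) {v : A → G}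
    (hv : ∀ a a', v (a + a') = v a * v a') {σ τ : AddMonoid.End A} {t : ℤ} (hστ : σ * τ = 1)
    (hτσ : τ * σ = 1) (ht : σ + τ = t) (ht4 : 4 ≤ t) {b : G} (hσ : ∀ a, b * v a = v (σ a) * b)
    (hτ : ∀ a, b⁻¹ * v a = v (τ a) * b⁻¹) (a : A) :
    ∃ K : ℕ, ∀ k N : ℕ, N < 2 ^ k → wordLength X (v (N • a)) ≤ K * (k + 1) := by
  have hv0 : v 0 = 1 := by
    have := hv 0 0
    rwa [add_zero, left_eq_mul] at this
  have hvn : ∀ c : ℕ, v (c • a) = v a ^ c := fun c => by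
    induction c with
    | zero => rw [zero_smul, pow_zero, hv0]
    | succ c ih => rw [succ_nsmul, hv, ih, pow_succ]
  set C := t.toNat * wordLength X (v a) + wordLength X b with hC
  have main : ∀ k N : ℕ, (N : ℤ) < traceSeq t k → ∃ x y : A, x + y = N • a ∧
      wordLength X (v x * b ^ k) ≤ C * (k + 1) ∧ wordLength X (v y * b⁻¹ ^ k) ≤ C * (k + 1) := by
    intro k
    induction k with
    | zero =>
      intro N hN
      refine ⟨0, N • a, zero_add _, ?_, ?_⟩
      · rw [hv0, pow_zero, mul_one, wordLength_one]
        exact Nat.zero_le _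
      · rw [pow_zero, mul_one, hvn, zero_add, mul_one, hC]
        refine (wordLength_pow_le hX _ _).trans (le_add_right (Nat.mul_le_mul_right _ ?_))
        simp only [traceSeq] at hN
        omega
    | succ k ih =>
      intro N hN
      obtain ⟨L, hL⟩ : ∃ L : ℕ, traceSeq t k = L :=
        ⟨_, (Int.toNat_of_nonneg (traceSeq_pos_and_two_mul_le ht4 k).1.le).symm⟩
      have hL0 : 0 < L := by
        have := (traceSeq_pos_and_two_mul_le ht4 k).1
        omega
      obtain ⟨x, y, hxy, hx, hy⟩ := ih (N % L) (by
        rw [hL]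
        exact_mod_cast Nat.mod_lt _ hL0)
      set c := N / L
      have hct : c ≤ t.toNat := by
        refine (Nat.div_lt_of_lt_mul ?_).le
        zify
        rw [Int.toNat_of_nonneg (by omega), ← hL, mul_comm]
        exact hN.trans_le (traceSeq_succ_le ht4 k)
      have hcv : wordLength X (v (c • a)) ≤ t.toNat * wordLength X (v a) := by
        rw [hvn]
        exact (wordLength_pow_le hX _ _).trans (Nat.mul_le_mul_right _ hct)
      have hsum : (σ ^ k) (c • a) + (τ ^ k) (c • a) = (L * c) • a := by
        have h := congrArg (fun e : AddMonoid.End A => e (c • a))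
          (pow_add_pow_eq_traceSeq hστ hτσ ht k)
        rw [hL] at h
        rw [Int.cast_natCast] at h
        exact h.trans (mul_smul L c a).symm
      refine ⟨x + (σ ^ k) (c • a), y + (τ ^ k) (c • a), ?_, ?_, ?_⟩
      · rw [add_add_add_comm, hxy, hsum, ← add_smul, Nat.mod_add_div]
      · rw [hv, pow_succ, ← mul_assoc, mul_assoc (v x), ← pow_mul_map_eq hσ, ← mul_assoc]
        have h1 := wordLength_mul_le hX (v x * b ^ k * v (c • a)) b
        have h2 := wordLength_mul_le hX (v x * b ^ k) (v (c • a))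
        rw [mul_add C (k + 1), mul_one]
        omega
      · rw [hv, pow_succ, ← mul_assoc, mul_assoc (v y), ← pow_mul_map_eq hτ, ← mul_assoc]
        have h1 := wordLength_mul_le hX (v y * b⁻¹ ^ k * v (c • a)) b⁻¹
        have h2 := wordLength_mul_le hX (v y * b⁻¹ ^ k) (v (c • a))
        have h3 := wordLength_inv_le hX b
        rw [mul_add C (k + 1), mul_one]
        omega
  refine ⟨2 * C + 2 * wordLength X b, fun k N hN => ?_⟩
  obtain ⟨x, y, hxy, hx, hy⟩ := main k N
    (lt_of_lt_of_le (by exact_mod_cast hN) (two_pow_le_traceSeq ht4 k))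
  have h0 : v (N • a) = (v x * b ^ k) * b⁻¹ ^ k * ((v y * b⁻¹ ^ k) * b ^ k) := by
    rw [← hxy, hv, inv_pow, mul_inv_cancel_right, inv_mul_cancel_right]
  have h1 := wordLength_mul_le hX ((v x * b ^ k) * b⁻¹ ^ k) ((v y * b⁻¹ ^ k) * b ^ k)
  have h2 := wordLength_mul_le hX (v x * b ^ k) (b⁻¹ ^ k)
  have h3 := wordLength_mul_le hX (v y * b⁻¹ ^ k) (b ^ k)
  have h4 := wordLength_pow_le hX b k
  have h5 := (wordLength_pow_le hX b⁻¹ k).trans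
    (Nat.mul_le_mul_left k (wordLength_inv_le hX b))
  rw [h0]
  nlinarith

end Distortion

lemma Nat.lcmUpto_le_two_pow (m : ℕ) : Nat.lcmUpto m ≤ 2 ^ (8 * m) := by
  have h0 : (0 : ℝ) < Nat.lcmUpto m := by exact_mod_cast Nat.lcmUpto_pos m
  have h1 := Chebyshev.psi_le_const_mul_self (Nat.cast_nonneg (α := ℝ) m)
  rw [Chebyshev.psi_eq_log_lcmUpto, show (4 : ℝ) = 2 ^ 2 by norm_num, Real.log_pow] at h1
  have h2 := Real.log_two_gt_d9
  have h3 : Real.log (Nat.lcmUpto m) ≤ Real.log ((2 : ℝ) ^ (8 * m)) := by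
    rw [Real.log_pow]
    push_cast at h1 ⊢
    nlinarith [Nat.cast_nonneg (α := ℝ) m]
  exact_mod_cast (Real.log_le_log_iff h0 (by positivity)).1 h3

namespace Matrix.SpecialLinearGroup

section UnipotentAbelian

variable {ι : Type*} [Fintype ι] [DecidableEq ι] {i j k : ι}

lemma transvection_mul_transvection_mul {R : Type*} [CommRing R] (hik : i ≠ k) (hjk : j ≠ k)
    (a b c d : R) :
    transvection hik (a + c) * transvection hjk (b + d) =
      transvection hik a * transvection hjk b * (transvection hik c * transvection hjk d) := by
  refine Subtype.ext ?_
  simp only [coe_mul, coe_transvection', mul_add, add_mul, one_mul, mul_one, single_add,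
    single_mul_single_of_ne _ _ _ _ hik.symm, single_mul_single_of_ne _ _ _ _ hjk.symm,
    add_zero]
  abel

lemma mul_transvection_mul_transvection {R : Type*} [CommRing R] (hij : i ≠ j) (hik : i ≠ k)
    (hjk : j ≠ k) (f x y : R) :
    transvection hij f * transvection hij.symm f *
        (transvection hik (f * x) * transvection hjk (f * y)) =
      transvection hik (f * ((1 + f ^ 2) * x + f * y)) * transvection hjk (f * (f * x + y)) *
        (transvection hij f * transvection hij.symm f) := by
  obtain ⟨E, hE⟩ : ∃ E : ι → ι → Matrix ι ι R, ∀ i j a, single i j a = a • E i j :=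
    ⟨fun i j => single i j 1, fun i j a => by rw [smul_single, smul_eq_mul, mul_one]⟩
  refine Subtype.ext ?_
  simp only [coe_mul, coe_transvection', mul_add, add_mul, one_mul, mul_one,
    single_mul_single_same, single_mul_single_of_ne _ _ _ _ hik.symm,
    single_mul_single_of_ne _ _ _ _ hjk.symm, single_mul_single_of_ne _ _ _ _ hij.symm,
    single_mul_single_of_ne _ _ _ _ hij, add_zero]
  simp only [hE]
  module

/-- Unipotent elements of a subgroup of `SL_n(ℤ)` containing many transvections are exponentially
distorted. -/
theorem exists_wordLength_transvection_le (hij : i ≠ j) (hik : i ≠ k) (hjk : j ≠ k)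
    {D : Subgroup (SpecialLinearGroup ι ℤ)} {X : Set D} (hX : Subgroup.closure X = ⊤) {f : ℕ}
    (hf2 : 2 ≤ f) (hf : ∀ (i j : ι) (hij : i ≠ j) (a : ℤ), transvection hij (f * a) ∈ D) :
    ∃ K : ℕ, ∀ l N : ℕ, N < 2 ^ l →
      wordLength X (⟨transvection hik (f * (N : ℤ)), hf i k hik N⟩ : D) ≤ K * (l + 1) := by
  set v : ℤ × ℤ → D := fun p => ⟨transvection hik (f * p.1) * transvection hjk (f * p.2),
    D.mul_mem (hf _ _ _ _) (hf _ _ _ _)⟩ with hv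
  set b : D := ⟨transvection hij (f : ℤ) * transvection hij.symm (f : ℤ),
    D.mul_mem (by simpa using hf i j hij 1) (by simpa using hf j i hij.symm 1)⟩
  set σ : AddMonoid.End (ℤ × ℤ) := AddMonoidHom.mk'
    (fun p => ((1 + (f : ℤ) ^ 2) * p.1 + f * p.2, f * p.1 + p.2))
    (fun p q => by ext <;> simp <;> ring)
  set τ : AddMonoid.End (ℤ × ℤ) := AddMonoidHom.mk'
    (fun p => (p.1 - f * p.2, (1 + (f : ℤ) ^ 2) * p.2 - f * p.1))
    (fun p q => by ext <;> simp <;> ring)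
  have hστ : σ * τ = 1 := by
    refine AddMonoidHom.ext fun p => Prod.ext ?_ ?_
    · change (1 + (f : ℤ) ^ 2) * (p.1 - f * p.2) + f * ((1 + (f : ℤ) ^ 2) * p.2 - f * p.1) = p.1
      ring
    · change f * (p.1 - f * p.2) + ((1 + (f : ℤ) ^ 2) * p.2 - f * p.1) = p.2
      ring
  have hτσ : τ * σ = 1 := by
    refine AddMonoidHom.ext fun p => Prod.ext ?_ ?_
    · change (1 + (f : ℤ) ^ 2) * p.1 + f * p.2 - f * (f * p.1 + p.2) = p.1
      ring
    · change (1 + (f : ℤ) ^ 2) * (f * p.1 + p.2) - f * ((1 + (f : ℤ) ^ 2) * p.1 + f * p.2) = p.2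
      ring
  have ht : σ + τ = ((2 + (f : ℤ) ^ 2 : ℤ) : AddMonoid.End (ℤ × ℤ)) := by
    refine AddMonoidHom.ext fun p => Prod.ext ?_ ?_
    · change (1 + (f : ℤ) ^ 2) * p.1 + f * p.2 + (p.1 - f * p.2) = (2 + (f : ℤ) ^ 2) * p.1
      ring
    · change f * p.1 + p.2 + ((1 + (f : ℤ) ^ 2) * p.2 - f * p.1) = (2 + (f : ℤ) ^ 2) * p.2
      ring
  have hστ' : ∀ p, σ (τ p) = p := DFunLike.congr_fun hστ
  have hbσ : ∀ p, b * v p = v (σ p) * b := fun p =>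
    Subtype.ext (mul_transvection_mul_transvection hij hik hjk _ _ _)
  have hbτ : ∀ p, b⁻¹ * v p = v (τ p) * b⁻¹ := fun p => by
    rw [inv_mul_eq_iff_eq_mul, ← mul_assoc, eq_mul_inv_iff_mul_eq, hbσ, hστ']
  obtain ⟨K, hK⟩ := exists_wordLength_map_nsmul_le hX (v := v) (fun p q => Subtype.ext (by
    rw [hv]
    simp only [Prod.fst_add, Prod.snd_add, mul_add]
    exact transvection_mul_transvection_mul hik hjk _ _ _ _)) hστ hτσ ht
    (by nlinarith [(Nat.cast_le (α := ℤ)).2 hf2]) hbσ hbτ (1, 0)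
  refine ⟨K, fun l N hN => ?_⟩
  convert hK l N hN using 2
  refine Subtype.ext ?_
  have h0 : transvection hjk (0 : ℤ) = 1 := Subtype.ext (Matrix.transvection_zero j k)
  simp only [hv, Prod.smul_mk, nsmul_eq_mul, mul_one, mul_zero, h0]

end UnipotentAbelian

lemma residuallyFinite_subgroup {ι : Type*} [Fintype ι] [DecidableEq ι]
    (D : Subgroup (SpecialLinearGroup ι ℤ)) : ResiduallyFinite D := by
  intro g hg
  obtain ⟨i, j, hij⟩ : ∃ i j, g.1.1 i j ≠ (1 : Matrix ι ι ℤ) i j := by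
    by_contra! h
    exact hg (Subtype.ext (Subtype.ext (Matrix.ext h)))
  set q := (g.1.1 i j - (1 : Matrix ι ι ℤ) i j).natAbs + 1
  have : NeZero q := ⟨by omega⟩
  set φ := (map (n := ι) (Int.castRingHom (ZMod q))).comp D.subtype
  refine ⟨φ.ker, inferInstance, inferInstance, fun h => ?_⟩
  have h1 := congrArg (fun A : SpecialLinearGroup ι (ZMod q) => A.1 i j) h
  have h2 : ((g.1.1 i j - (1 : Matrix ι ι ℤ) i j : ℤ) : ZMod q) = 0 := by
    rw [Int.cast_sub, sub_eq_zero]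
    refine Eq.trans h1 ?_
    by_cases hij : i = j
    · subst hij; simp
    · simp [hij]
  rw [ZMod.intCast_zmod_eq_zero_iff_dvd, Int.natCast_dvd] at h2
  have := Nat.le_of_dvd (Int.natAbs_pos.2 (sub_ne_zero.2 hij)) h2
  omega

lemma exists_forall_transvection_mem {ι : Type*} [Fintype ι] [DecidableEq ι]
    (D : Subgroup (SpecialLinearGroup ι ℤ)) [D.FiniteIndex] :
    ∃ f : ℕ, 2 ≤ f ∧ ∀ (i j : ι) (hij : i ≠ j) (a : ℤ), transvection hij (f * a) ∈ D := by
  have h0 := D.normalCore.index_ne_zero_of_finite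
  refine ⟨2 * D.normalCore.index, by omega, fun i j hij a => D.normalCore_le ?_⟩
  have h := D.normalCore.pow_index_mem (transvection hij (2 * a))
  rw [← zpow_natCast, transvection_zpow] at h
  convert h using 2
  push_cast
  ring

end Matrix.SpecialLinearGroup

lemma exists_farbD_eq_index {G : Type*} [Group G] (hG : ResiduallyFinite G) {g : G} (hg : g ≠ 1) :
    ∃ N : Subgroup G, N.Normal ∧ N.FiniteIndex ∧ g ∉ N ∧ N.index = farbD g := by
  refine Nat.sInf_mem
    (s := {k | ∃ N : Subgroup G, N.Normal ∧ N.FiniteIndex ∧ g ∉ N ∧ N.index = k}) ?_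
  obtain ⟨N, h1, h2, h3⟩ := hG g hg
  exact ⟨_, N, h1, h2, h3, rfl⟩

lemma farbD_le_farbF {G : Type*} [Group G] {X : Set G} (hXf : X.Finite)
    (hX : Subgroup.closure X = ⊤) {g : G} (hg : g ≠ 1) {n : ℕ} (hn : wordLength X g ≤ n) :
    farbD g ≤ farbF X n := by
  refine le_csSup (Set.Finite.bddAbove ?_) ⟨g, hg, hn, rfl⟩
  refine ((finite_setOf_wordLength_le hXf hX n).image farbD).subset ?_
  rintro _ ⟨h, -, hh, rfl⟩
  exact ⟨h, hh, rfl⟩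

/-- For `n ≥ 3` and `Δ` a finite-index subgroup of `SL_n(ℤ)`, the
group `Δ` is finitely generated and residually finite, and its normal Farb
growth function (w.r.t. any finite generating set) is `≽ N ^ (n² - 1)`. -/
theorem farb_growth_lower_bound_finite_index_SL_int (n : ℕ) (hn : 3 ≤ n)
    (Δ : Subgroup (Matrix.SpecialLinearGroup (Fin n) ℤ)) (hΔ : Δ.FiniteIndex) :
    Group.FG Δ ∧ ResiduallyFinite Δ ∧
      ∀ Y : Finset Δ, Subgroup.closure (Y : Set Δ) = ⊤ →
        FarbPreceq (fun N => N ^ (n ^ 2 - 1)) (farbF (Y : Set Δ)) := by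
  have hRF := Matrix.SpecialLinearGroup.residuallyFinite_subgroup Δ
  refine ⟨inferInstance, hRF, fun Y hY => ?_⟩
  obtain ⟨f, hf2, hf⟩ := Matrix.SpecialLinearGroup.exists_forall_transvection_mem Δ
  have h01 : (⟨0, by omega⟩ : Fin n) ≠ ⟨1, by omega⟩ := by simp
  have h02 : (⟨0, by omega⟩ : Fin n) ≠ ⟨2, by omega⟩ := by simp
  have h12 : (⟨1, by omega⟩ : Fin n) ≠ ⟨2, by omega⟩ := by simp
  obtain ⟨K, hK⟩ := Matrix.SpecialLinearGroup.exists_wordLength_transvection_le h01 h02 h12 hY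
    hf2 hf
  set C := 2 ^ n * (n * 2) * Δ.index * (f ^ 7) ^ (n ^ 2 - 1)
  refine ⟨C + K * 10 + 1, by omega, fun N => ?_⟩
  rcases Nat.eq_zero_or_pos N with rfl | hN
  · have : n ^ 2 - 1 ≠ 0 := by
      have : 3 ^ 2 ≤ n ^ 2 := Nat.pow_le_pow_left hn 2
      omega
    simp [this]
  set g : Δ := ⟨Matrix.SpecialLinearGroup.transvection h02 (f * (Nat.lcmUpto N : ℤ)),
    hf _ _ _ _⟩ with hg
  have hg1 : g ≠ 1 := fun h => by
    have h1 := congrArg (fun x : Δ => x.1.1 ⟨0, by omega⟩ ⟨2, by omega⟩) h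
    have h2 : (f : ℤ) * Nat.lcmUpto N = 0 := by
      simpa [hg, Matrix.SpecialLinearGroup.coe_transvection', h02] using h1
    have h3 := Nat.lcmUpto_ne_zero N
    rcases mul_eq_zero.1 h2 with h | h <;> omega
  have hwl : wordLength (Y : Set Δ) g ≤ (C + K * 10 + 1) * N := by
    refine (hK (8 * N + 1) _ ((Nat.lcmUpto_le_two_pow N).trans_lt
      (Nat.pow_lt_pow_right one_lt_two (Nat.lt_succ_self _)))).trans ?_
    nlinarith [Nat.zero_le (C * N), Nat.mul_le_mul_left K hN]
  obtain ⟨P, hP, hPf, hgP, hPi⟩ := exists_farbD_eq_index hRF hg1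
  have h1 := Matrix.SpecialLinearGroup.pow_le_index_of_transvection_notMem hn
    (by omega : f ≠ 0) hf P h02 hgP
  rw [hPi] at h1
  exact h1.trans (Nat.mul_le_mul (by omega) (farbD_le_farbF Y.finite_toSet hY hg1 hwl))
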